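/- There exists a universal constant ξ > 0 such that for every m ∈ ℕ with m ≥ 2, every ε ∈ [-1,1], and every adversary strategy b in the simple online binomial game with m rounds and parameter ε, the bias achieved by b satisfies |E[O_I − O_I⁻]| ≤ ξ·log³ m / m. -/

import Mathlib

noncomputable def binPMF (n : ℕ) (ε : ℝ) (k : ℤ) : ℝ :=
  if ((n : ℤ) + k) % 2 = 0 ∧ -(n : ℤ) ≤ k ∧ k ≤ (n : ℤ) then
    (n.choose (((n : ℤ) + k) / 2).toNat : ℝ) *
      ((1 + ε) / 2) ^ (((n : ℤ) + k) / 2).toNat *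
      ((1 - ε) / 2) ^ (((n : ℤ) - k) / 2).toNat
  else 0

noncomputable def binTail (n : ℕ) (ε : ℝ) (k : ℤ) : ℝ :=
  ∑ t ∈ Finset.Icc k (n : ℤ), binPMF n ε t

def lRound (m i : ℕ) : ℕ := m + 1 - i

def sRound (m i : ℕ) : ℕ := ∑ j ∈ Finset.Icc i m, lRound m j

/-- `Y_r`: the partial sum `k₀ + X_1 + ⋯ + X_r` along a trajectory of coin outcomes. -/
def partY (m : ℕ) (k0 : ℤ) (x : Fin m → ℤ) (r : ℕ) : ℤ :=
  k0 + ∑ j ∈ Finset.univ.filter (fun j : Fin m => (j : ℕ) < r), x j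

/-- Probability of a full trajectory of coins and hints in the online binomial game:
round `i+1` flips `ℓ_{i+1} = m - i` coins (summing to `x i`) and then samples the hint
`h i` from the distribution `hint (i+1) (Y_{i+1})`. -/
noncomputable def trajProb {H : Type} (m : ℕ) (ε : ℝ) (k0 : ℤ) (hint : ℕ → ℤ → H → ℝ)
    (x : Fin m → ℤ) (h : Fin m → H) : ℝ :=
  ∏ i : Fin m,
    (binPMF (lRound m ((i : ℕ) + 1)) ε (x i) *
      hint ((i : ℕ) + 1) (partY m k0 x ((i : ℕ) + 1)) (h i))

/-- `O_r⁻ = Pr[Y_m ≥ 0 ∣ Y_{r-1} = y]`. -/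
noncomputable def roundOminus (m : ℕ) (ε : ℝ) (r : ℕ) (y : ℤ) : ℝ :=
  binTail (sRound m r) ε (-y)

/-- `O_r = Pr[Y_m ≥ 0 ∣ Y_{r-1} = y, H_r = hv]`, computed by Bayes' rule over the value
of the round-`r` coin sum. -/
noncomputable def roundO {H : Type} (m : ℕ) (ε : ℝ) (hint : ℕ → ℤ → H → ℝ)
    (r : ℕ) (y : ℤ) (hv : H) : ℝ :=
  (∑ z ∈ Finset.Icc (-(lRound m r : ℤ)) (lRound m r : ℤ),
      binPMF (lRound m r) ε z * hint r (y + z) hv * binTail (sRound m (r + 1)) ε (-(y + z))) /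
  (∑ z ∈ Finset.Icc (-(lRound m r : ℤ)) (lRound m r : ℤ),
      binPMF (lRound m r) ε z * hint r (y + z) hv)

/-- The first round (as an element of `Fin m`, round `i` corresponding to `(i : ℕ) + 1`)
in which the adversary strategy `b` aborts, or `none` if it never aborts. -/
noncomputable def stopIdx {H : Type} (m : ℕ) (k0 : ℤ) (b : ℕ → ℤ → H → Bool)
    (x : Fin m → ℤ) (h : Fin m → H) : Option (Fin m) :=
  if hex : (Finset.univ.filter
      (fun i : Fin m => b ((i : ℕ) + 1) (partY m k0 x (i : ℕ)) (h i) = true)).Nonempty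
  then some ((Finset.univ.filter
      (fun i : Fin m => b ((i : ℕ) + 1) (partY m k0 x (i : ℕ)) (h i) = true)).min' hex)
  else none

/-- `O_I - O_I⁻` along a trajectory; it is `0` when the adversary never aborts, since
`O_{m+1} = O_{m+1}⁻`. -/
noncomputable def trajGain {H : Type} (m : ℕ) (ε : ℝ) (k0 : ℤ) (hint : ℕ → ℤ → H → ℝ)
    (b : ℕ → ℤ → H → Bool) (x : Fin m → ℤ) (h : Fin m → H) : ℝ :=
  match stopIdx m k0 b x h with
  | some i =>
      roundO m ε hint ((i : ℕ) + 1) (partY m k0 x (i : ℕ)) (h i) -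
        roundOminus m ε ((i : ℕ) + 1) (partY m k0 x (i : ℕ))
  | none => 0

/-- The bias `|E[O_I - O_I⁻]|` achieved by the adversary strategy `b` in the online
binomial game with `m` rounds, coin parameter `ε`, offset `k0` and hint distributions
`hint`. -/
noncomputable def gameBias {H : Type} (m : ℕ) (ε : ℝ) (k0 : ℤ) (hint : ℕ → ℤ → H → ℝ)
    (b : ℕ → ℤ → H → Bool) : ℝ :=
  |∑' q : (Fin m → ℤ) × (Fin m → H),
      trajProb m ε k0 hint q.1 q.2 * trajGain m ε k0 hint b q.1 q.2|

/-- The hint distribution of the simple game: in round `r`, the hint is `true` with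
probability `V(s_{r+1}, ε)(-y)` given `Y_r = y`. -/
noncomputable def simpleHint (m : ℕ) (ε : ℝ) : ℕ → ℤ → Bool → ℝ := fun r y hv =>
  if hv then binTail (sRound m (r + 1)) ε (-y) else 1 - binTail (sRound m (r + 1)) ε (-y)

/-- The averaging operator of one coin: `(coinStep ε F) y = E[F (y + X)]` for `X ~ Ber(ε)`. -/
noncomputable def coinStep (ε : ℝ) : Module.End ℝ (ℤ → ℝ) :=
  ((1 + ε) / 2) • LinearMap.funLeft ℝ ℝ (fun y : ℤ => y + 1) +
    ((1 - ε) / 2) • LinearMap.funLeft ℝ ℝ (fun y : ℤ => y - 1)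

lemma coinStep_apply (ε : ℝ) (F : ℤ → ℝ) (y : ℤ) :
    coinStep ε F y = (1 + ε) / 2 * F (y + 1) + (1 - ε) / 2 * F (y - 1) := by
  simp [coinStep, LinearMap.funLeft_apply]

lemma coinStep_pow_succ (ε : ℝ) (n : ℕ) (F : ℤ → ℝ) :
    (coinStep ε ^ (n + 1)) F = (coinStep ε ^ n) (coinStep ε F) := by
  rw [pow_succ, Module.End.mul_apply]

lemma coinStep_pow_succ' (ε : ℝ) (n : ℕ) (F : ℤ → ℝ) :
    (coinStep ε ^ (n + 1)) F = coinStep ε ((coinStep ε ^ n) F) := by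
  rw [pow_succ', Module.End.mul_apply]

lemma coinStep_pow_add (ε : ℝ) (n k : ℕ) (F : ℤ → ℝ) :
    (coinStep ε ^ (n + k)) F = (coinStep ε ^ n) ((coinStep ε ^ k) F) := by
  rw [pow_add, Module.End.mul_apply]

lemma coinStep_pow_mono {ε : ℝ} (hε : ε ∈ Set.Icc (-1 : ℝ) 1) (n : ℕ) {F G : ℤ → ℝ}
    (h : ∀ y, F y ≤ G y) (y : ℤ) : (coinStep ε ^ n) F y ≤ (coinStep ε ^ n) G y := by
  induction n generalizing F G with
  | zero => simpa using h y
  | succ n ih =>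
    rw [coinStep_pow_succ, coinStep_pow_succ]
    refine ih fun z => ?_
    rw [coinStep_apply, coinStep_apply]
    have h1 : 0 ≤ (1 + ε) / 2 := by linarith [hε.1]
    have h2 : 0 ≤ (1 - ε) / 2 := by linarith [hε.2]
    gcongr <;> apply h

lemma coinStep_pow_const (ε : ℝ) (n : ℕ) (c : ℝ) (y : ℤ) :
    (coinStep ε ^ n) (fun _ => c) y = c := by
  induction n with
  | zero => simp
  | succ n ih =>
    have : coinStep ε (fun _ => c) = fun _ => c := by
      funext z; rw [coinStep_apply]; ring
    rw [coinStep_pow_succ, this, ih]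

lemma coinStep_pow_nonneg {ε : ℝ} (hε : ε ∈ Set.Icc (-1 : ℝ) 1) (n : ℕ) {F : ℤ → ℝ}
    (h : ∀ y, 0 ≤ F y) (y : ℤ) : 0 ≤ (coinStep ε ^ n) F y := by
  simpa [coinStep_pow_const] using coinStep_pow_mono hε n (F := fun _ => 0) h y

/-- The discrete derivative `F (y + 1) - F (y - 1)`. -/
def symmDiff₂ (F : ℤ → ℝ) : ℤ → ℝ := fun y => F (y + 1) - F (y - 1)

lemma coinStep_translate (ε : ℝ) (n : ℕ) (F : ℤ → ℝ) (c y : ℤ) :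
    (coinStep ε ^ n) (fun z => F (z + c)) y = (coinStep ε ^ n) F (y + c) := by
  induction n generalizing F with
  | zero => simp
  | succ n ih =>
    have : coinStep ε (fun z => F (z + c)) = fun z => coinStep ε F (z + c) := by
      funext z
      rw [coinStep_apply, coinStep_apply, add_right_comm, sub_add_eq_add_sub]
    rw [coinStep_pow_succ, coinStep_pow_succ, this, ih]

lemma coinStep_pow_symmDiff₂ (ε : ℝ) (n : ℕ) (F : ℤ → ℝ) :
    (coinStep ε ^ n) (symmDiff₂ F) = symmDiff₂ ((coinStep ε ^ n) F) := by
  funext y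
  have : symmDiff₂ F = (fun z => F (z + 1)) - fun z => F (z + (-1)) := by
    funext z; simp [symmDiff₂, sub_eq_add_neg]
  rw [this, map_sub, Pi.sub_apply, coinStep_translate, coinStep_translate]
  simp [symmDiff₂, sub_eq_add_neg]

/-- Jensen's inequality for the square under the binomial average of one coin. -/
lemma coinStep_sq_le {ε : ℝ} (hε : ε ∈ Set.Icc (-1 : ℝ) 1) (F : ℤ → ℝ) (y : ℤ) :
    (coinStep ε F y) ^ 2 ≤ coinStep ε (fun z => F z ^ 2) y := by
  rw [coinStep_apply, coinStep_apply]
  have h : 0 ≤ (1 + ε) / 2 * ((1 - ε) / 2) := by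
    apply mul_nonneg <;> linarith [hε.1, hε.2]
  nlinarith [mul_nonneg h (sq_nonneg (F (y + 1) - F (y - 1)))]

/-- Efron–Stein: the variance of `F` under `n + 1` coins is controlled by the mean squared
discrete derivative under `n` coins. -/
lemma coinStep_variance_le {ε : ℝ} (hε : ε ∈ Set.Icc (-1 : ℝ) 1) (n : ℕ) (F : ℤ → ℝ) (y : ℤ) :
    (coinStep ε ^ (n + 1)) (fun z => F z ^ 2) y - ((coinStep ε ^ (n + 1)) F y) ^ 2 ≤
      (n + 1) * ((1 - ε ^ 2) / 4) * (coinStep ε ^ n) (fun z => symmDiff₂ F z ^ 2) y := by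
  have hq : 0 ≤ (1 - ε ^ 2) / 4 := by nlinarith [hε.1, hε.2]
  have step : ∀ G : ℤ → ℝ, coinStep ε (fun z => G z ^ 2) =
      (fun z => coinStep ε G z ^ 2) + ((1 - ε ^ 2) / 4) • fun z => symmDiff₂ G z ^ 2 := by
    intro G
    funext z
    simp only [Pi.add_apply, Pi.smul_apply, smul_eq_mul, coinStep_apply, symmDiff₂]
    ring
  induction n generalizing F with
  | zero =>
    have := congrFun (step F) y
    simp only [Pi.add_apply, Pi.smul_apply, smul_eq_mul] at this
    simp only [zero_add, pow_one, pow_zero, Module.End.one_apply, this]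
    simp
  | succ n ih =>
    rw [coinStep_pow_succ _ (n + 1), step, map_add, map_smul, coinStep_pow_succ _ (n + 1) F]
    simp only [Pi.add_apply, Pi.smul_apply, smul_eq_mul]
    have h1 := ih (coinStep ε F)
    have h2 : (coinStep ε ^ n) (fun z => symmDiff₂ (coinStep ε F) z ^ 2) y ≤
        (coinStep ε ^ (n + 1)) (fun z => symmDiff₂ F z ^ 2) y := by
      rw [coinStep_pow_succ]
      refine coinStep_pow_mono hε n (fun z => ?_) y
      have := coinStep_pow_symmDiff₂ ε 1 F
      rw [pow_one] at this
      rw [← this]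
      exact coinStep_sq_le hε _ _
    have h3 : 0 ≤ ((n : ℝ) + 1) * ((1 - ε ^ 2) / 4) := by positivity
    have h4 := mul_le_mul_of_nonneg_left h2 h3
    push_cast
    linarith

/-- Stein's identity for sums of coins. -/
lemma coinStep_stein (ε : ℝ) (n : ℕ) (h : ℤ → ℝ) (y : ℤ) :
    (coinStep ε ^ (n + 1)) (fun z => ((z : ℝ) - y - (n + 1) * ε) * h z) y =
      2 * (n + 1) * ((1 - ε ^ 2) / 4) * (coinStep ε ^ n) (symmDiff₂ h) y := by
  have step : ∀ G : ℤ → ℝ, coinStep ε (fun z : ℤ => (z : ℝ) * G z) =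
      (fun z : ℤ => (z : ℝ) * coinStep ε G z) + ε • coinStep ε G +
        (2 * ((1 - ε ^ 2) / 4)) • symmDiff₂ G := by
    intro G
    funext z
    simp only [Pi.add_apply, Pi.smul_apply, smul_eq_mul, coinStep_apply, symmDiff₂]
    push_cast
    ring
  have key : ∀ G : ℤ → ℝ, (coinStep ε ^ (n + 1)) (fun z : ℤ => (z : ℝ) * G z) y =
      (y + (n + 1) * ε) * (coinStep ε ^ (n + 1)) G y +
        2 * (n + 1) * ((1 - ε ^ 2) / 4) * (coinStep ε ^ n) (symmDiff₂ G) y := by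
    clear h
    induction n with
    | zero =>
      intro G
      have := congrFun (step G) y
      simp only [Pi.add_apply, Pi.smul_apply, smul_eq_mul] at this
      simp only [zero_add, pow_one, pow_zero, Module.End.one_apply, this]
      push_cast
      ring
    | succ n ih =>
      intro G
      rw [coinStep_pow_succ _ (n + 1), step, map_add, map_add, map_smul, map_smul,
        coinStep_pow_succ _ (n + 1) G]
      simp only [Pi.add_apply, Pi.smul_apply, smul_eq_mul]
      have hD := coinStep_pow_symmDiff₂ ε 1 G
      rw [pow_one] at hD
      rw [ih, ← hD, ← coinStep_pow_succ _ n (symmDiff₂ G)]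
      push_cast
      ring
  have e : (fun z : ℤ => ((z : ℝ) - y - (n + 1) * ε) * h z) =
      (fun z : ℤ => (z : ℝ) * h z) - ((y : ℝ) + (n + 1) * ε) • h := by
    funext z
    simp only [Pi.sub_apply, Pi.smul_apply, smul_eq_mul]
    ring
  rw [e, map_sub, map_smul, Pi.sub_apply, key, Pi.smul_apply, smul_eq_mul]
  ring

/-- Moment generating function bound for sums of coins. -/
lemma coinStep_exp_le {ε : ℝ} (hε : ε ∈ Set.Icc (-1 : ℝ) 1) (n : ℕ) {l : ℝ} (hl : |l| ≤ 1 / 2)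
    (y : ℤ) :
    (coinStep ε ^ n) (fun z => Real.exp (l * ((z : ℝ) - y - n * ε))) y ≤
      Real.exp (n * l ^ 2) := by
  set ρ : ℝ := (1 + ε) / 2 * Real.exp l + (1 - ε) / 2 * Real.exp (-l) with hρ
  have hp : 0 ≤ (1 + ε) / 2 := by linarith [hε.1]
  have hp' : 0 ≤ (1 - ε) / 2 := by linarith [hε.2]
  have hρ0 : 0 ≤ ρ := by positivity
  have heig : ∀ c : ℝ, (coinStep ε ^ n) (fun z => Real.exp (l * z + c)) y =
      ρ ^ n * Real.exp (l * y + c) := by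
    intro c
    induction n with
    | zero => simp
    | succ n ih =>
      have : coinStep ε (fun z => Real.exp (l * z + c)) =
          ρ • fun z : ℤ => Real.exp (l * z + c) := by
        funext z
        rw [coinStep_apply, Pi.smul_apply, smul_eq_mul, hρ, add_mul, mul_assoc, mul_assoc,
          ← Real.exp_add, ← Real.exp_add]
        push_cast
        ring_nf
      rw [coinStep_pow_succ, this, map_smul, Pi.smul_apply, ih, smul_eq_mul]
      ring
  have hρle : ρ ≤ Real.exp (l ^ 2 + l * ε) := by
    have hb : ∀ x : ℝ, |x| ≤ 1 → Real.exp x ≤ 1 + x + x ^ 2 := fun x hx => by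
      linarith [(abs_le.1 (Real.abs_exp_sub_one_sub_id_le hx)).2]
    obtain ⟨hl1, hl2⟩ := abs_le.1 hl
    have b1 := hb (l * (1 - ε)) (by
      rw [abs_mul]
      have : |1 - ε| ≤ 2 := abs_le.2 ⟨by linarith [hε.2], by linarith [hε.1]⟩
      nlinarith [abs_nonneg l, abs_nonneg (1 - ε)])
    have b2 := hb (-(l * (1 + ε))) (by
      rw [abs_neg, abs_mul]
      have : |1 + ε| ≤ 2 := abs_le.2 ⟨by linarith [hε.1], by linarith [hε.2]⟩
      nlinarith [abs_nonneg l, abs_nonneg (1 + ε)])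
    have e1 : ρ = ((1 + ε) / 2 * Real.exp (l * (1 - ε)) +
        (1 - ε) / 2 * Real.exp (-(l * (1 + ε)))) * Real.exp (l * ε) := by
      rw [hρ, add_mul, mul_assoc, mul_assoc, ← Real.exp_add, ← Real.exp_add]
      ring_nf
    rw [e1, Real.exp_add]
    refine mul_le_mul_of_nonneg_right ?_ (Real.exp_pos _).le
    have b3 := Real.add_one_le_exp (l ^ 2)
    have c1 := mul_le_mul_of_nonneg_left b1 hp
    have c2 := mul_le_mul_of_nonneg_left b2 hp'
    nlinarith [mul_nonneg (sq_nonneg l) (sq_nonneg ε)]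
  have e2 : (fun z : ℤ => Real.exp (l * ((z : ℝ) - y - n * ε))) =
      fun z : ℤ => Real.exp (l * z + (-(l * y) - n * (l * ε))) := by
    funext z; ring_nf
  rw [e2, heig]
  calc ρ ^ n * Real.exp (l * y + (-(l * y) - n * (l * ε)))
      ≤ Real.exp (l ^ 2 + l * ε) ^ n * Real.exp (l * y + (-(l * y) - n * (l * ε))) := by gcongr
    _ = Real.exp (n * l ^ 2) := by
      rw [← Real.exp_nat_mul, ← Real.exp_add]; ring_nf

/-- Tail version of Stein's identity: the mean derivative of a `[0, 1]`-valued function is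
controlled by its mean, up to an exponentially small error. -/
lemma coinStep_symmDiff₂_le {ε : ℝ} (hε : ε ∈ Set.Icc (-1 : ℝ) 1) (n : ℕ) {h : ℤ → ℝ}
    (h0 : ∀ z, 0 ≤ h z) (h1 : ∀ z, h z ≤ 1) {σ : ℝ} (hσ : σ ^ 2 = 1) (L : ℝ) (y : ℤ) :
    (1 - ε ^ 2) / 4 * (σ * (coinStep ε ^ n) (symmDiff₂ h) y) ≤
      (L * (coinStep ε ^ (n + 1)) h y + 2 * Real.exp (-L)) / √((n : ℝ) + 1) := by
  set r : ℝ := √((n : ℝ) + 1) with hr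
  have hr2 : r ^ 2 = n + 1 := Real.sq_sqrt (by positivity)
  have hr1 : 1 ≤ r := Real.one_le_sqrt.2 (by simp)
  have hr0 : 0 < r := by linarith
  have hσa : |σ| = 1 := by rw [← sq_eq_sq₀ (abs_nonneg σ) zero_le_one, sq_abs, hσ, one_pow]
  have hst := coinStep_stein ε n h y
  set l : ℝ := 1 / (2 * r) with hl
  have hl0 : 0 < l := by positivity
  have hle : ∀ z : ℤ, (σ • fun z : ℤ => ((z : ℝ) - y - (n + 1) * ε) * h z) z ≤
      ((2 * r * L) • h + (2 * r * Real.exp (-L)) •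
        fun z : ℤ => Real.exp ((l * σ) * ((z : ℝ) - y - ((n + 1 : ℕ) : ℝ) * ε))) z := by
    intro z
    simp only [Pi.add_apply, Pi.smul_apply, smul_eq_mul]
    push_cast
    set x : ℝ := (z : ℝ) - y - (n + 1) * ε
    have e1 : Real.exp (-L) * Real.exp (l * σ * x) = Real.exp (l * σ * x - L) := by
      rw [← Real.exp_add]; ring_nf
    have e2 := Real.add_one_le_exp (l * σ * x - L)
    have e3 : (σ * x - 2 * r * L) * h z ≤ 2 * r * Real.exp (l * σ * x - L) := by
      have e4 : σ * x - 2 * r * L = 2 * r * (l * σ * x - L) := by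
        rw [hl]; field_simp
      rw [e4, mul_assoc]
      refine mul_le_mul_of_nonneg_left ?_ (by positivity)
      have e5 : (l * σ * x - L) ≤ Real.exp (l * σ * x - L) := by linarith
      calc (l * σ * x - L) * h z ≤ Real.exp (l * σ * x - L) * h z :=
            mul_le_mul_of_nonneg_right e5 (h0 z)
        _ ≤ Real.exp (l * σ * x - L) * 1 :=
            mul_le_mul_of_nonneg_left (h1 z) (Real.exp_pos _).le
        _ = _ := mul_one _
    rw [mul_assoc (2 * r) (Real.exp (-L)), e1]
    linarith
  have hm := coinStep_pow_mono hε (n + 1) hle y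
  rw [map_smul, map_add, map_smul, map_smul] at hm
  simp only [Pi.add_apply, Pi.smul_apply, smul_eq_mul] at hm
  rw [hst] at hm
  have hexp := coinStep_exp_le hε (n + 1) (l := l * σ) (by
    rw [abs_mul, hσa, mul_one, abs_of_pos hl0, hl]
    exact one_div_le_one_div_of_le (by norm_num) (by linarith)) y
  have hexp2 : Real.exp (((n + 1 : ℕ) : ℝ) * (l * σ) ^ 2) ≤ 2 := by
    have : ((n + 1 : ℕ) : ℝ) * (l * σ) ^ 2 = 1 / 4 := by
      rw [mul_pow, hσ]
      push_cast
      rw [← hr2, hl]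
      field_simp
      norm_num
    rw [this]
    have := Real.abs_exp_sub_one_sub_id_le (x := 1 / 4) (by norm_num [abs_le])
    linarith [(abs_le.1 this).2]
  have hm2 : 2 * ((n : ℝ) + 1) * ((1 - ε ^ 2) / 4 * (σ * (coinStep ε ^ n) (symmDiff₂ h) y)) ≤
      2 * r * (L * (coinStep ε ^ (n + 1)) h y + 2 * Real.exp (-L)) := by
    have : 2 * r * Real.exp (-L) * (coinStep ε ^ (n + 1))
        (fun z : ℤ => Real.exp ((l * σ) * ((z : ℝ) - y - ((n + 1 : ℕ) : ℝ) * ε))) y ≤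
        2 * r * Real.exp (-L) * 2 :=
      mul_le_mul_of_nonneg_left (hexp.trans hexp2) (by positivity)
    linarith
  rw [le_div_iff₀ hr0]
  rw [← hr2] at hm2
  refine le_of_mul_le_mul_left ?_ (show (0 : ℝ) < 2 * r by positivity)
  linarith

lemma binPMF_eq_zero {n : ℕ} {ε : ℝ} {k : ℤ}
    (hk : k ∉ (Finset.range (n + 1)).image fun j : ℕ => 2 * (j : ℤ) - n) : binPMF n ε k = 0 := by
  rw [binPMF, if_neg]
  rintro ⟨h1, h2, h3⟩
  refine hk (Finset.mem_image.2 ⟨(((n : ℤ) + k) / 2).toNat, ?_, ?_⟩)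
  · rw [Finset.mem_range]; omega
  · omega

lemma binPMF_two_mul_sub {n j : ℕ} (hj : j ≤ n) (ε : ℝ) :
    binPMF n ε (2 * (j : ℤ) - n) =
      n.choose j * ((1 + ε) / 2) ^ j * ((1 - ε) / 2) ^ (n - j) := by
  have e1 : (((n : ℤ) + (2 * (j : ℤ) - n)) / 2).toNat = j := by omega
  have e2 : (((n : ℤ) - (2 * (j : ℤ) - n)) / 2).toNat = n - j := by omega
  rw [binPMF, if_pos (by omega), e1, e2]

lemma binPMF_nonneg {ε : ℝ} (hε : ε ∈ Set.Icc (-1 : ℝ) 1) (n : ℕ) (k : ℤ) :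
    0 ≤ binPMF n ε k := by
  have h1 : 0 ≤ (1 + ε) / 2 := by linarith [hε.1]
  have h2 : 0 ≤ (1 - ε) / 2 := by linarith [hε.2]
  unfold binPMF
  split_ifs <;> positivity

lemma coinStep_pow_eq_sum_range (ε : ℝ) (n : ℕ) (F : ℤ → ℝ) (y : ℤ) :
    (coinStep ε ^ n) F y = ∑ j ∈ Finset.range (n + 1),
      n.choose j * ((1 + ε) / 2) ^ j * ((1 - ε) / 2) ^ (n - j) * F (y + (2 * (j : ℤ) - n)) := by
  have hpow : ∀ (c : ℤ) (j : ℕ) (G : ℤ → ℝ),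
      (LinearMap.funLeft ℝ ℝ (fun z : ℤ => z + c) ^ j) G = fun z => G (z + j * c) := by
    intro c j
    induction j with
    | zero => intro G; simp
    | succ j ih =>
      intro G
      rw [pow_succ, Module.End.mul_apply, ih]
      funext z
      rw [LinearMap.funLeft_apply]
      congr 1
      push_cast
      ring
  have hcomm : Commute (((1 + ε) / 2) • LinearMap.funLeft ℝ ℝ (fun z : ℤ => z + 1))
      (((1 - ε) / 2) • LinearMap.funLeft ℝ ℝ (fun z : ℤ => z + (-1))) := by
    refine (Commute.smul_left ?_ _).smul_right _
    refine LinearMap.ext fun G => funext fun z => ?_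
    simp [Module.End.mul_apply, LinearMap.funLeft_apply]
  have hdef : coinStep ε = ((1 + ε) / 2) • LinearMap.funLeft ℝ ℝ (fun z : ℤ => z + 1) +
      ((1 - ε) / 2) • LinearMap.funLeft ℝ ℝ (fun z : ℤ => z + (-1)) := rfl
  rw [hdef, hcomm.add_pow, LinearMap.sum_apply, Finset.sum_apply]
  refine Finset.sum_congr rfl fun j hj => ?_
  have hj' : j ≤ n := Nat.lt_succ_iff.1 (Finset.mem_range.1 hj)
  rw [smul_pow, smul_pow, ← nsmul_eq_mul', LinearMap.smul_apply, Module.End.mul_apply,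
    LinearMap.smul_apply, LinearMap.smul_apply, hpow, hpow]
  simp only [Pi.smul_apply, smul_eq_mul, nsmul_eq_mul]
  have : y + j * 1 + ((n - j : ℕ) : ℤ) * (-1) = y + (2 * (j : ℤ) - n) := by
    push_cast [Nat.cast_sub hj']; ring
  rw [this]
  ring

/-- Averages against the binomial distribution are powers of `coinStep`. -/
lemma sum_binPMF_mul {n M : ℕ} (hM : n ≤ M) (ε : ℝ) (F : ℤ → ℝ) (y : ℤ) :
    ∑ z ∈ Finset.Icc (-(M : ℤ)) M, binPMF n ε z * F (y + z) = (coinStep ε ^ n) F y := by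
  have hsub : (Finset.range (n + 1)).image (fun j : ℕ => 2 * (j : ℤ) - n) ⊆
      Finset.Icc (-(M : ℤ)) M := by
    intro z hz
    obtain ⟨j, hj, rfl⟩ := Finset.mem_image.1 hz
    rw [Finset.mem_range] at hj
    rw [Finset.mem_Icc]
    omega
  rw [← Finset.sum_subset hsub fun z _ hz => by rw [binPMF_eq_zero hz, zero_mul],
    Finset.sum_image (fun a _ b _ hab => by simpa using hab), coinStep_pow_eq_sum_range]
  refine Finset.sum_congr rfl fun j hj => ?_
  rw [binPMF_two_mul_sub (Nat.lt_succ_iff.1 (Finset.mem_range.1 hj))]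

/-- The indicator of the nonnegative integers. -/
noncomputable def nonnegInd (z : ℤ) : ℝ := if 0 ≤ z then 1 else 0

lemma nonnegInd_nonneg (z : ℤ) : 0 ≤ nonnegInd z := by
  unfold nonnegInd; split_ifs <;> norm_num

lemma nonnegInd_le_one (z : ℤ) : nonnegInd z ≤ 1 := by
  unfold nonnegInd; split_ifs <;> norm_num

lemma binTail_neg (n : ℕ) (ε : ℝ) (y : ℤ) :
    binTail n ε (-y) = (coinStep ε ^ n) nonnegInd y := by
  rw [← sum_binPMF_mul le_rfl, binTail]
  have : ∀ z : ℤ, binPMF n ε z * nonnegInd (y + z) = if -y ≤ z then binPMF n ε z else 0 := by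
    intro z
    unfold nonnegInd
    by_cases h : -y ≤ z
    · rw [if_pos h, if_pos (by omega), mul_one]
    · rw [if_neg h, if_neg (by omega), mul_zero]
  simp_rw [this]
  rw [← Finset.sum_filter]
  symm
  refine Finset.sum_subset (fun z hz => ?_) fun z hz hz' => ?_
  · simp only [Finset.mem_filter, Finset.mem_Icc] at hz ⊢
    omega
  · simp only [Finset.mem_filter, Finset.mem_Icc] at hz hz'
    rw [binPMF, if_neg]
    omega

lemma sRound_eq_add {m k : ℕ} (hk : k ≤ m) : sRound m k = lRound m k + sRound m (k + 1) := by
  unfold sRound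
  have : Finset.Ioc k m = Finset.Icc (k + 1) m := by ext; simp
  rw [← Finset.add_sum_Ioc_eq_sum_Icc hk, this]

lemma two_mul_sRound {m k : ℕ} (hk : k ≤ m + 1) :
    2 * sRound m k = lRound m k * (lRound m k + 1) := by
  induction hk using Nat.decreasingInduction with
  | self => simp [sRound, lRound]
  | of_succ k hk ih =>
    have hk' : k ≤ m := Nat.lt_succ_iff.1 hk
    rw [sRound_eq_add hk', mul_add, ih]
    have : lRound m k = lRound m (k + 1) + 1 := by unfold lRound; omega
    rw [this]
    ring

lemma Finset.sum_piFinset_const_succ {α M : Type*} [AddCommMonoid M] {n : ℕ} (S : Finset α)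
    (F : (Fin (n + 1) → α) → M) :
    ∑ x ∈ Fintype.piFinset (fun _ : Fin (n + 1) => S), F x =
      ∑ a ∈ S, ∑ x ∈ Fintype.piFinset (fun _ : Fin n => S), F (Fin.cons a x) := by
  rw [← Finset.sum_product']
  refine (Finset.sum_nbij' (fun q => Fin.cons q.1 q.2) (fun x => (x 0, Fin.tail x))
    ?_ ?_ ?_ ?_ ?_).symm
  · intro q hq
    simp only [Finset.mem_product, Fintype.mem_piFinset] at hq ⊢
    intro i
    cases i using Fin.cases with
    | zero => simpa using hq.1
    | succ i => simpa using hq.2 i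
  · intro x hx
    simp only [Finset.mem_product, Fintype.mem_piFinset] at hx ⊢
    exact ⟨hx 0, fun i => hx i.succ⟩
  · intro q _; simp
  · intro x _; simp
  · intro q _; rfl

lemma partY_cons_succ {n : ℕ} (y a : ℤ) (x : Fin n → ℤ) (r : ℕ) :
    partY (n + 1) y (Fin.cons a x) (r + 1) = partY n (y + a) x r := by
  unfold partY
  rw [Finset.sum_filter, Finset.sum_filter, Fin.sum_univ_succ]
  simp [add_assoc]

lemma partY_zero {n : ℕ} (y : ℤ) (x : Fin n → ℤ) : partY n y x 0 = y := by
  simp [partY]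

lemma stopIdx_cons_of_true {H : Type} {n : ℕ} {y : ℤ} {b : ℕ → ℤ → H → Bool} (x : Fin (n + 1) → ℤ)
    {h : Fin (n + 1) → H} (hb : b 1 y (h 0) = true) :
    stopIdx (n + 1) y b x h = some 0 := by
  have hmem : (0 : Fin (n + 1)) ∈ Finset.univ.filter (fun i : Fin (n + 1) =>
      b ((i : ℕ) + 1) (partY (n + 1) y x (i : ℕ)) (h i) = true) := by
    simpa [partY_zero] using hb
  rw [stopIdx, dif_pos ⟨0, hmem⟩]
  exact congrArg some (le_antisymm (Finset.min'_le _ _ hmem) (Fin.zero_le _))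

lemma stopIdx_cons_of_false {H : Type} {n : ℕ} {y a : ℤ} {b : ℕ → ℤ → H → Bool} {x : Fin n → ℤ}
    {c : H} {h : Fin n → H} (hb : b 1 y c = false) :
    stopIdx (n + 1) y b (Fin.cons a x) (Fin.cons c h) =
      (stopIdx n (y + a) (fun k => b (k + 1)) x h).map Fin.succ := by
  have hset : Finset.univ.filter (fun i : Fin (n + 1) => b ((i : ℕ) + 1)
      (partY (n + 1) y (Fin.cons a x) (i : ℕ)) (Fin.cons (α := fun _ => H) c h i) = true) =
      (Finset.univ.filter (fun i : Fin n => b ((i : ℕ) + 1 + 1)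
        (partY n (y + a) x (i : ℕ)) (h i) = true)).image Fin.succ := by
    ext i
    cases i using Fin.cases with
    | zero => simp [partY_zero, hb]
    | succ i => simp [partY_cons_succ]
  unfold stopIdx
  simp only [hset]
  by_cases hne : (Finset.univ.filter (fun i : Fin n => b ((i : ℕ) + 1 + 1)
        (partY n (y + a) x (i : ℕ)) (h i) = true)).Nonempty
  · rw [dif_pos (hne.image _), dif_pos hne, Option.map_some]
    refine congrArg some (le_antisymm ?_ ?_)
    · exact Finset.min'_le _ _ (Finset.mem_image_of_mem _ (Finset.min'_mem _ hne))
    · refine Finset.le_min' _ _ _ fun j hj => ?_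
      obtain ⟨k, hk, rfl⟩ := Finset.mem_image.1 hj
      exact Fin.succ_le_succ_iff.2 (Finset.min'_le _ _ hk)
  · rw [dif_neg (by rwa [Finset.image_nonempty]), dif_neg hne, Option.map_none]

/-- Weight of a trajectory in a stopping game with coin weights `W` and hint weights `hint`. -/
noncomputable def pathWeight {H : Type} (n : ℕ) (W : ℕ → ℤ → ℝ) (hint : ℕ → ℤ → H → ℝ) (y : ℤ)
    (x : Fin n → ℤ) (h : Fin n → H) : ℝ :=
  ∏ i : Fin n, (W ((i : ℕ) + 1) (x i) * hint ((i : ℕ) + 1) (partY n y x ((i : ℕ) + 1)) (h i))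

/-- Payoff along a trajectory of the strategy `b` in a stopping game with payoffs `J`. -/
noncomputable def pathPayoff {H : Type} (n : ℕ) (b : ℕ → ℤ → H → Bool) (J : ℕ → ℤ → H → ℝ) (y : ℤ)
    (x : Fin n → ℤ) (h : Fin n → H) : ℝ :=
  match stopIdx n y b x h with
  | some i => J ((i : ℕ) + 1) (partY n y x (i : ℕ)) (h i)
  | none => 0

lemma pathWeight_cons {H : Type} {n : ℕ} (W : ℕ → ℤ → ℝ) (hint : ℕ → ℤ → H → ℝ) (y a : ℤ)
    (x : Fin n → ℤ) (c : H) (h : Fin n → H) :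
    pathWeight (n + 1) W hint y (Fin.cons a x) (Fin.cons c h) = W 1 a * hint 1 (y + a) c *
      pathWeight n (fun k => W (k + 1)) (fun k => hint (k + 1)) (y + a) x h := by
  unfold pathWeight
  rw [Fin.prod_univ_succ]
  simp only [Fin.val_zero, Fin.cons_zero, Fin.val_succ, Fin.cons_succ, partY_cons_succ,
    partY_zero]

lemma pathPayoff_cons {H : Type} {n : ℕ} (b : ℕ → ℤ → H → Bool) (J : ℕ → ℤ → H → ℝ) (y a : ℤ)
    (x : Fin n → ℤ) (c : H) (h : Fin n → H) :
    pathPayoff (n + 1) b J y (Fin.cons a x) (Fin.cons c h) = if b 1 y c then J 1 y c else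
      pathPayoff n (fun k => b (k + 1)) (fun k => J (k + 1)) (y + a) x h := by
  unfold pathPayoff
  split_ifs with hb
  · rw [stopIdx_cons_of_true _ (by simpa using hb)]
    simp [partY_zero]
  · rw [stopIdx_cons_of_false (by simpa using hb)]
    cases stopIdx n (y + a) (fun k => b (k + 1)) x h with
    | none => rfl
    | some i => simp [partY_cons_succ]

lemma sum_pathWeight {H : Type} [Fintype H] (n : ℕ) (S : Finset ℤ) (W : ℕ → ℤ → ℝ)
    (hint : ℕ → ℤ → H → ℝ) (hW : ∀ k < n, ∑ a ∈ S, W (k + 1) a = 1)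
    (hh : ∀ k < n, ∀ y, ∑ c, hint (k + 1) y c = 1) (y : ℤ) :
    ∑ x ∈ Fintype.piFinset (fun _ : Fin n => S),
      ∑ h ∈ Fintype.piFinset (fun _ : Fin n => (Finset.univ : Finset H)),
        pathWeight n W hint y x h = 1 := by
  induction n generalizing W hint y with
  | zero => simp [pathWeight]
  | succ n ih =>
    rw [Finset.sum_piFinset_const_succ]
    simp only [Finset.sum_piFinset_const_succ, pathWeight_cons]
    rw [← hW 0 n.succ_pos]
    refine Finset.sum_congr rfl fun a _ => ?_
    rw [Finset.sum_comm]
    simp only [← Finset.mul_sum]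
    simp only [ih (fun k => W (k + 1)) (fun k => hint (k + 1)) (fun k hk => hW (k + 1) (by omega))
      (fun k hk => hh (k + 1) (by omega)), mul_one]
    rw [← Finset.mul_sum]
    have := hh 0 n.succ_pos (y + a)
    rw [zero_add] at this
    rw [this, mul_one]

/-- Verification theorem: the expected payoff of a stopping strategy is bounded by any nonnegative
function that dominates, in one step, the better of stopping and continuing. -/
lemma sum_pathWeight_mul_pathPayoff_le {H : Type} [Fintype H] (n : ℕ) (S : Finset ℤ)
    (W : ℕ → ℤ → ℝ) (hint : ℕ → ℤ → H → ℝ) (b : ℕ → ℤ → H → Bool) (J : ℕ → ℤ → H → ℝ)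
    (Φ : ℕ → ℤ → ℝ) (hW0 : ∀ k < n, ∀ a, 0 ≤ W (k + 1) a)
    (hW : ∀ k < n, ∑ a ∈ S, W (k + 1) a = 1)
    (hh0 : ∀ k < n, ∀ y c, 0 ≤ hint (k + 1) y c)
    (hh : ∀ k < n, ∀ y, ∑ c, hint (k + 1) y c = 1)
    (hΦ0 : ∀ y, 0 ≤ Φ (n + 1) y)
    (hΦ : ∀ k < n, ∀ y, ∑ a ∈ S, ∑ c, W (k + 1) a * hint (k + 1) (y + a) c *
      (if b (k + 1) y c then J (k + 1) y c else Φ (k + 2) (y + a)) ≤ Φ (k + 1) y) (y : ℤ) :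
    ∑ x ∈ Fintype.piFinset (fun _ : Fin n => S),
      ∑ h ∈ Fintype.piFinset (fun _ : Fin n => (Finset.univ : Finset H)),
        pathWeight n W hint y x h * pathPayoff n b J y x h ≤ Φ 1 y := by
  induction n generalizing W hint b J Φ y with
  | zero => simpa [pathPayoff, stopIdx] using hΦ0 y
  | succ n ih =>
    refine le_trans ?_ (hΦ 0 n.succ_pos y)
    rw [Finset.sum_piFinset_const_succ]
    simp only [Finset.sum_piFinset_const_succ, pathWeight_cons, pathPayoff_cons]
    refine Finset.sum_le_sum fun a _ => ?_
    rw [Finset.sum_comm]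
    refine Finset.sum_le_sum fun c _ => ?_
    simp only [mul_assoc (W 1 a * hint 1 (y + a) c), ← Finset.mul_sum]
    refine mul_le_mul_of_nonneg_left ?_ (mul_nonneg (hW0 0 n.succ_pos a) (hh0 0 n.succ_pos _ c))
    by_cases hb : b 1 y c = true
    · simp only [hb, zero_add, if_true, ← Finset.sum_mul]
      rw [sum_pathWeight n S _ _ (fun k hk => hW (k + 1) (by omega))
        (fun k hk => hh (k + 1) (by omega)), one_mul]
    · simp only [hb, zero_add]
      exact ih (fun k => W (k + 1)) (fun k => hint (k + 1)) (fun k => b (k + 1))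
        (fun k => J (k + 1)) (fun k => Φ (k + 1)) (fun k hk => hW0 (k + 1) (by omega))
        (fun k hk => hW (k + 1) (by omega)) (fun k hk => hh0 (k + 1) (by omega))
        (fun k hk => hh (k + 1) (by omega)) hΦ0 (fun k hk => hΦ (k + 1) (by omega)) (y + a)

/-- The success probability of the binomial game given that its first `k - 1` coin sums add up
to `y`. -/
noncomputable def winProb (m : ℕ) (ε : ℝ) (k : ℕ) : ℤ → ℝ := (coinStep ε ^ sRound m k) nonnegInd

lemma binTail_sRound (m : ℕ) (ε : ℝ) (k : ℕ) (y : ℤ) :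
    binTail (sRound m k) ε (-y) = winProb m ε k y :=
  binTail_neg _ _ _

lemma winProb_nonneg {ε : ℝ} (hε : ε ∈ Set.Icc (-1 : ℝ) 1) (m k : ℕ) (y : ℤ) :
    0 ≤ winProb m ε k y :=
  coinStep_pow_nonneg hε _ nonnegInd_nonneg y

lemma winProb_le_one {ε : ℝ} (hε : ε ∈ Set.Icc (-1 : ℝ) 1) (m k : ℕ) (y : ℤ) :
    winProb m ε k y ≤ 1 := by
  have := coinStep_pow_mono hε (sRound m k) nonnegInd_le_one y
  rwa [coinStep_pow_const] at this

lemma coinStep_pow_winProb {m k : ℕ} (hk : k ≤ m) (ε : ℝ) :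
    (coinStep ε ^ lRound m k) (winProb m ε (k + 1)) = winProb m ε k := by
  rw [winProb, winProb, sRound_eq_add hk, coinStep_pow_add]

/-- The conditional variance, in round `k`, of the success probability after that round. -/
noncomputable def winVar (m : ℕ) (ε : ℝ) (k : ℕ) (y : ℤ) : ℝ :=
  (coinStep ε ^ lRound m k) (fun z => winProb m ε (k + 1) z ^ 2) y - winProb m ε k y ^ 2

lemma coinStep_pow_one_sub_mul (ε : ℝ) (n : ℕ) (F G : ℤ → ℝ) (y : ℤ) :
    (coinStep ε ^ n) (fun z => (1 - F z) * G z) y =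
      (coinStep ε ^ n) G y - (coinStep ε ^ n) (fun z => F z * G z) y := by
  have : (fun z => (1 - F z) * G z) = G - fun z => F z * G z := by
    funext z; simp only [Pi.sub_apply]; ring
  rw [this, map_sub, Pi.sub_apply]

lemma coinStep_pow_one_sub (ε : ℝ) (n : ℕ) (F : ℤ → ℝ) (y : ℤ) :
    (coinStep ε ^ n) (fun z => 1 - F z) y = 1 - (coinStep ε ^ n) F y := by
  have : (fun z => 1 - F z) = (fun _ => (1 : ℝ)) - F := rfl
  rw [this, map_sub, Pi.sub_apply, coinStep_pow_const]

lemma winVar_nonneg {ε : ℝ} (hε : ε ∈ Set.Icc (-1 : ℝ) 1) {m k : ℕ} (hk : k ≤ m) (y : ℤ) :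
    0 ≤ winVar m ε k y := by
  set p := winProb m ε k y with hp
  have h := coinStep_pow_nonneg hε (lRound m k)
    (F := fun z => (winProb m ε (k + 1) z - p) ^ 2) (fun z => sq_nonneg _) y
  have e : (fun z => (winProb m ε (k + 1) z - p) ^ 2) =
      (fun z => winProb m ε (k + 1) z ^ 2) - (2 * p) • winProb m ε (k + 1) +
        fun _ => p ^ 2 := by
    funext z
    simp only [Pi.add_apply, Pi.sub_apply, Pi.smul_apply, smul_eq_mul]
    ring
  rw [e, map_add, map_sub, map_smul, coinStep_pow_winProb hk] at h
  simp only [Pi.add_apply, Pi.sub_apply, Pi.smul_apply, smul_eq_mul, coinStep_pow_const] at h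
  rw [winVar, ← hp]
  rw [← hp] at h
  linarith

lemma lRound_le {m k : ℕ} (hk : 1 ≤ k) : lRound m k ≤ m := by unfold lRound; omega

/-- Gain of aborting in round `k` on a given hint in the simple game. -/
noncomputable def simpleJump (m : ℕ) (ε : ℝ) (k : ℕ) (y : ℤ) (c : Bool) : ℝ :=
  roundO m ε (simpleHint m ε) k y c - roundOminus m ε k y

lemma winProb_mul_simpleJump {ε : ℝ} (hε : ε ∈ Set.Icc (-1 : ℝ) 1) {m k : ℕ} (hk : k ≤ m)
    (y : ℤ) : winProb m ε k y * simpleJump m ε k y true ∈ Set.Icc 0 (winVar m ε k y) := by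
  have hv := winVar_nonneg hε hk y
  have hJ : simpleJump m ε k y true =
      (coinStep ε ^ lRound m k) (fun z => winProb m ε (k + 1) z ^ 2) y / winProb m ε k y -
        winProb m ε k y := by
    simp only [simpleJump, roundO, roundOminus, simpleHint, binTail_sRound, if_true, mul_assoc,
      ← sq]
    rw [sum_binPMF_mul le_rfl ε (winProb m ε (k + 1)),
      sum_binPMF_mul le_rfl ε (fun z => winProb m ε (k + 1) z ^ 2), coinStep_pow_winProb hk]
  by_cases h0 : winProb m ε k y = 0
  · rw [h0, zero_mul]; exact ⟨le_rfl, hv⟩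
  · rw [hJ, mul_sub, mul_div_cancel₀ _ h0, ← sq]
    exact ⟨hv, le_rfl⟩

lemma one_sub_winProb_mul_simpleJump {ε : ℝ} (hε : ε ∈ Set.Icc (-1 : ℝ) 1) {m k : ℕ} (hk : k ≤ m)
    (y : ℤ) :
    (1 - winProb m ε k y) * simpleJump m ε k y false ∈ Set.Icc (-winVar m ε k y) 0 := by
  have hv := winVar_nonneg hε hk y
  have hJ : simpleJump m ε k y false = (winProb m ε k y -
      (coinStep ε ^ lRound m k) (fun z => winProb m ε (k + 1) z ^ 2) y) / (1 - winProb m ε k y) -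
        winProb m ε k y := by
    simp only [simpleJump, roundO, roundOminus, simpleHint, binTail_sRound, mul_assoc,
      Bool.false_eq_true, if_false]
    rw [sum_binPMF_mul le_rfl ε (fun z => 1 - winProb m ε (k + 1) z),
      sum_binPMF_mul le_rfl ε (fun z => (1 - winProb m ε (k + 1) z) * winProb m ε (k + 1) z),
      coinStep_pow_one_sub_mul, coinStep_pow_one_sub, coinStep_pow_winProb hk]
    simp only [← sq]
  by_cases h0 : 1 - winProb m ε k y = 0
  · rw [h0, zero_mul]; exact ⟨by linarith, le_rfl⟩
  · have : (1 - winProb m ε k y) * simpleJump m ε k y false = -winVar m ε k y := by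
      rw [hJ, mul_sub, mul_div_cancel₀ _ h0, winVar]
      ring
    rw [this]
    exact ⟨le_rfl, by linarith⟩

/-- A nonnegative function that dominates, in each round, the conditional variance plus the part
of its own conditional mean on either hint, bounds the bias in the simple game. -/
lemma gameBias_simple_le {m : ℕ} {ε : ℝ} (hε : ε ∈ Set.Icc (-1 : ℝ) 1)
    (b : ℕ → ℤ → Bool → Bool) (Φ : ℕ → ℤ → ℝ) (hΦ0 : ∀ k y, 0 ≤ Φ k y)
    (hΦ : ∀ k, k ≤ m → ∀ y, (coinStep ε ^ lRound m k) (Φ (k + 1)) y ≤ Φ k y)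
    (hΦt : ∀ k, k ≤ m → ∀ y, winVar m ε k y + (coinStep ε ^ lRound m k)
      (fun z => winProb m ε (k + 1) z * Φ (k + 1) z) y ≤ Φ k y)
    (hΦf : ∀ k, k ≤ m → ∀ y, winVar m ε k y + (coinStep ε ^ lRound m k)
      (fun z => (1 - winProb m ε (k + 1) z) * Φ (k + 1) z) y ≤ Φ k y) :
    gameBias m ε 0 (simpleHint m ε) b ≤ Φ 1 0 := by
  set S : Finset ℤ := Finset.Icc (-(m : ℤ)) m with hS
  set W : ℕ → ℤ → ℝ := fun k => binPMF (lRound m k) ε with hWdef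
  have key : ∀ s : ℝ, s ^ 2 = 1 → ∑ x ∈ Fintype.piFinset (fun _ : Fin m => S),
      ∑ h ∈ Fintype.piFinset (fun _ : Fin m => (Finset.univ : Finset Bool)),
        pathWeight m W (simpleHint m ε) 0 x h *
          pathPayoff m b (fun k y c => s * simpleJump m ε k y c) 0 x h ≤ Φ 1 0 := by
    intro s hs
    refine sum_pathWeight_mul_pathPayoff_le m S W (simpleHint m ε) b _ Φ
      (fun k _ a => binPMF_nonneg hε _ a) (fun k _ => ?_) (fun k _ y c => ?_)
      (fun k _ y => ?_) (hΦ0 _) (fun k hk y => ?_) 0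
    · have := sum_binPMF_mul (lRound_le (m := m) (Nat.le_add_left 1 k)) ε (fun _ => 1) 0
      simpa [coinStep_pow_const] using this
    · simp only [simpleHint, binTail_sRound]
      split_ifs
      · exact winProb_nonneg hε _ _ _
      · linarith [winProb_le_one hε m (k + 1 + 1) y]
    · simp [simpleHint]
    · have hkm : k + 1 ≤ m := hk
      have hl := lRound_le (m := m) (Nat.le_add_left 1 k)
      have hc : ∀ (v : ℝ) (F : ℤ → ℝ), ∑ a ∈ S, W (k + 1) a * F (y + a) * v =
          (coinStep ε ^ lRound m (k + 1)) F y * v := fun v F => by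
        rw [← Finset.sum_mul, sum_binPMF_mul hl]
      have hm : ∀ F G : ℤ → ℝ, ∑ a ∈ S, W (k + 1) a * F (y + a) * G (y + a) =
          (coinStep ε ^ lRound m (k + 1)) (fun z => F z * G z) y := fun F G => by
        rw [← sum_binPMF_mul hl]
        exact Finset.sum_congr rfl fun a _ => mul_assoc _ _ _
      have ht := winProb_mul_simpleJump hε hkm y
      have hf := one_sub_winProb_mul_simpleJump hε hkm y
      have h1 := hΦ (k + 1) hkm y
      have h2 := hΦt (k + 1) hkm y
      have h3 := hΦf (k + 1) hkm y
      have h4 := coinStep_pow_nonneg hε (lRound m (k + 1))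
        (F := fun z => winProb m ε (k + 1 + 1) z * Φ (k + 1 + 1) z)
        (fun z => mul_nonneg (winProb_nonneg hε _ _ _) (hΦ0 _ _)) y
      have h5 := coinStep_pow_one_sub_mul ε (lRound m (k + 1)) (winProb m ε (k + 1 + 1))
        (Φ (k + 1 + 1)) y
      have hs' : s = 1 ∨ s = -1 := mul_self_eq_one_iff.1 (by rwa [← sq])
      simp only [Fintype.sum_bool, simpleHint, binTail_sRound, if_true, Bool.false_eq_true,
        if_false, Finset.sum_add_distrib]
      cases hbt : b (k + 1) y true <;> cases hbf : b (k + 1) y false <;>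
        simp only [if_true, Bool.false_eq_true, if_false]
      · rw [hm (winProb m ε (k + 1 + 1)) (Φ (k + 2)),
          hm (fun z => 1 - winProb m ε (k + 1 + 1) z) (Φ (k + 2))]
        linarith
      · rw [hm (winProb m ε (k + 1 + 1)) (Φ (k + 2)),
          hc _ (fun z => 1 - winProb m ε (k + 1 + 1) z), coinStep_pow_one_sub,
          coinStep_pow_winProb hkm]
        rcases hs' with rfl | rfl <;> linarith [hf.1, hf.2]
      · rw [hm (fun z => 1 - winProb m ε (k + 1 + 1) z) (Φ (k + 2)),
          hc _ (winProb m ε (k + 1 + 1)), coinStep_pow_winProb hkm]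
        rcases hs' with rfl | rfl <;> linarith [ht.1, ht.2]
      · rw [hc _ (winProb m ε (k + 1 + 1)), hc _ (fun z => 1 - winProb m ε (k + 1 + 1) z),
          coinStep_pow_one_sub, coinStep_pow_winProb hkm]
        rcases hs' with rfl | rfl <;> linarith [hf.1, hf.2, ht.1, ht.2]
  have hpay : ∀ (s : ℝ) (x : Fin m → ℤ) (h : Fin m → Bool),
      pathPayoff m b (fun k y c => s * simpleJump m ε k y c) 0 x h =
        s * trajGain m ε 0 (simpleHint m ε) b x h := by
    intro s x h
    unfold pathPayoff trajGain
    cases stopIdx m 0 b x h with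
    | none => simp
    | some i => rfl
  have hsum : ∑' q : (Fin m → ℤ) × (Fin m → Bool),
      trajProb m ε 0 (simpleHint m ε) q.1 q.2 * trajGain m ε 0 (simpleHint m ε) b q.1 q.2 =
      ∑ x ∈ Fintype.piFinset (fun _ : Fin m => S),
        ∑ h ∈ Fintype.piFinset (fun _ : Fin m => (Finset.univ : Finset Bool)),
          pathWeight m W (simpleHint m ε) 0 x h * trajGain m ε 0 (simpleHint m ε) b x h := by
    rw [← Finset.sum_product']
    refine tsum_eq_sum fun q hq => ?_
    simp only [Finset.mem_product, Fintype.mem_piFinset, Finset.mem_univ, implies_true, and_true,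
      not_forall] at hq
    obtain ⟨i, hi⟩ := hq
    rw [trajProb, Finset.prod_eq_zero (Finset.mem_univ i), zero_mul]
    have hl := lRound_le (m := m) (Nat.le_add_left 1 (i : ℕ))
    rw [hS, Finset.mem_Icc] at hi
    rw [binPMF, if_neg (by omega), zero_mul]
  rw [gameBias, hsum, abs_le']
  have kp := key 1 (by norm_num)
  have kn := key (-1) (by norm_num)
  simp only [hpay] at kp kn
  simp only [one_mul, neg_mul, mul_neg, Finset.sum_neg_distrib] at kp kn
  exact ⟨kp, kn⟩

/-- The bias in the simple game is at most the variance of its outcome. -/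
lemma gameBias_simple_le_variance {m : ℕ} {ε : ℝ} (hε : ε ∈ Set.Icc (-1 : ℝ) 1)
    (b : ℕ → ℤ → Bool → Bool) :
    gameBias m ε 0 (simpleHint m ε) b ≤ winProb m ε 1 0 * (1 - winProb m ε 1 0) := by
  have h0 : ∀ k y, 0 ≤ winProb m ε k y := winProb_nonneg hε m
  have h1 : ∀ k y, 0 ≤ 1 - winProb m ε k y := fun k y => by linarith [winProb_le_one hε m k y]
  have hmean : ∀ k, k ≤ m → ∀ y, (coinStep ε ^ lRound m k)
      (fun z => winProb m ε (k + 1) z * (1 - winProb m ε (k + 1) z)) y =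
        winProb m ε k y * (1 - winProb m ε k y) - winVar m ε k y := by
    intro k hk y
    have := coinStep_pow_one_sub_mul ε (lRound m k) (winProb m ε (k + 1)) (winProb m ε (k + 1)) y
    simp only [← sq] at this
    simp only [mul_comm (winProb m ε (k + 1) _), this]
    rw [coinStep_pow_winProb hk, winVar]
    ring
  refine gameBias_simple_le hε b (fun k y => winProb m ε k y * (1 - winProb m ε k y))
    (fun k y => mul_nonneg (h0 k y) (h1 k y)) (fun k hk y => ?_) (fun k hk y => ?_)
    (fun k hk y => ?_)
  · linarith [hmean k hk y, winVar_nonneg hε hk y]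
  · have := coinStep_pow_mono hε (lRound m k) (F := fun z => winProb m ε (k + 1) z *
      (winProb m ε (k + 1) z * (1 - winProb m ε (k + 1) z)))
      (fun z => mul_le_of_le_one_left (mul_nonneg (h0 (k + 1) z) (h1 (k + 1) z))
        (by linarith [h1 (k + 1) z])) y
    linarith [hmean k hk y]
  · have := coinStep_pow_mono hε (lRound m k) (F := fun z => (1 - winProb m ε (k + 1) z) *
      (winProb m ε (k + 1) z * (1 - winProb m ε (k + 1) z)))
      (fun z => mul_le_of_le_one_left (mul_nonneg (h0 (k + 1) z) (h1 (k + 1) z))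
        (by linarith [h0 (k + 1) z])) y
    linarith [hmean k hk y]

lemma coinStep_pow_zero_le_of_drift {ε : ℝ} (hε : ε ∈ Set.Icc (-1 : ℝ) 1) {n : ℕ} (hn : 0 < n)
    {σ : ℝ} (hσ : σ ^ 2 = 1) (hd : σ * ε ≤ -1 / 2) {h : ℤ → ℝ}
    (hh : ∀ z : ℤ, h z ≤ Real.exp (σ / 4 * z)) : (coinStep ε ^ n) h 0 ≤ 16 / n := by
  have hn' : (0 : ℝ) < n := by exact_mod_cast hn
  have hσa : |σ| = 1 := by rw [← sq_eq_sq₀ (abs_nonneg σ) zero_le_one, sq_abs, hσ, one_pow]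
  have h1 := coinStep_pow_mono hε n (G := Real.exp (n * (σ * ε) / 4) •
    fun z : ℤ => Real.exp (σ / 4 * ((z : ℝ) - (0 : ℤ) - n * ε))) (fun z => (hh z).trans_eq (by
      rw [Pi.smul_apply, smul_eq_mul, ← Real.exp_add]
      push_cast
      ring_nf)) 0
  rw [map_smul, Pi.smul_apply, smul_eq_mul] at h1
  have h2 := coinStep_exp_le hε n (l := σ / 4) (by rw [abs_div, hσa]; norm_num [abs_of_pos]) 0
  have h3 : Real.exp (n * (σ * ε) / 4) * Real.exp (n * (σ / 4) ^ 2) ≤ Real.exp (-(n / 16)) := by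
    rw [← Real.exp_add, Real.exp_le_exp, div_pow, hσ]
    nlinarith
  have h4 : Real.exp (-((n : ℝ) / 16)) ≤ 16 / n := by
    rw [Real.exp_neg, show (16 : ℝ) / n = (n / 16 : ℝ)⁻¹ from (inv_div _ _).symm]
    refine inv_anti₀ (by positivity) ?_
    linarith [Real.add_one_le_exp ((n : ℝ) / 16)]
  calc _ ≤ _ := h1
    _ ≤ Real.exp (n * (σ * ε) / 4) * Real.exp (n * (σ / 4) ^ 2) :=
      mul_le_mul_of_nonneg_left h2 (Real.exp_pos _).le
    _ ≤ _ := h3.trans h4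

lemma symmDiff₂_nonnegInd_nonneg (z : ℤ) : 0 ≤ symmDiff₂ nonnegInd z := by
  unfold symmDiff₂ nonnegInd
  split_ifs <;> first | (exfalso; omega) | norm_num

/-- The potential for coins that are not too biased: up to constants, the probability that the
final sum lands near zero, plus a small error. -/
noncomputable def localPotential (ε L : ℝ) (n : ℕ) (y : ℤ) : ℝ :=
  2 * L * ((coinStep ε ^ n) (symmDiff₂ nonnegInd) (y - 1) +
    (coinStep ε ^ n) (symmDiff₂ nonnegInd) (y + 1)) + 16 * Real.exp (-L)

lemma localPotential_nonneg {ε : ℝ} (hε : ε ∈ Set.Icc (-1 : ℝ) 1) {L : ℝ} (hL : 0 ≤ L) (n : ℕ)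
    (y : ℤ) : 0 ≤ localPotential ε L n y := by
  have h := fun y => coinStep_pow_nonneg hε n symmDiff₂_nonnegInd_nonneg y
  have h1 := h (y - 1)
  have h2 := h (y + 1)
  unfold localPotential
  positivity

lemma coinStep_pow_localPotential (ε L : ℝ) (n k : ℕ) (y : ℤ) :
    (coinStep ε ^ n) (localPotential ε L k) y = localPotential ε L (n + k) y := by
  set f := (coinStep ε ^ k) (symmDiff₂ nonnegInd) with hf
  have : localPotential ε L k = (2 * L) • ((fun z => f (z + (-1))) + fun z => f (z + 1)) +
      fun _ => 16 * Real.exp (-L) := rfl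
  rw [this, map_add, map_smul, map_add]
  simp only [Pi.add_apply, Pi.smul_apply, smul_eq_mul]
  rw [coinStep_translate, coinStep_translate, coinStep_pow_const, hf, localPotential,
    coinStep_pow_add]
  rfl

/-- The variance over `l` coins of a conditional mean `R` is dominated by the mean of `R` times
the local potential. -/
lemma coinStep_variance_le_localPotential {ε : ℝ} (hε : |ε| ≤ 1 / 2) {L : ℝ} (hL : 0 ≤ L)
    {N l : ℕ} (hl : 1 ≤ l) (hlN : l ^ 2 ≤ 4 * (N + 1)) {h : ℤ → ℝ} (h0 : ∀ z, 0 ≤ h z)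
    (h1 : ∀ z, h z ≤ 1) {σ : ℝ} (hσ : σ ^ 2 = 1)
    (hh : σ • symmDiff₂ h = symmDiff₂ nonnegInd) (y : ℤ) :
    (coinStep ε ^ l) (fun z => (coinStep ε ^ N) h z ^ 2) y -
      ((coinStep ε ^ l) ((coinStep ε ^ N) h) y) ^ 2 ≤
      (coinStep ε ^ l) (fun z => (coinStep ε ^ N) h z * localPotential ε L N z) y := by
  obtain ⟨hε1, hε2⟩ := abs_le.1 hε
  have hεI : ε ∈ Set.Icc (-1 : ℝ) 1 := ⟨by linarith, by linarith⟩
  obtain ⟨l, rfl⟩ : ∃ k, l = k + 1 := ⟨l - 1, by omega⟩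
  set R := (coinStep ε ^ N) h with hR
  set f := (coinStep ε ^ N) (symmDiff₂ nonnegInd) with hf
  have hR0 : ∀ z, 0 ≤ R z := coinStep_pow_nonneg hεI N h0
  have hf0 : ∀ z, 0 ≤ f z := coinStep_pow_nonneg hεI N symmDiff₂_nonnegInd_nonneg
  have hfR : ∀ z, f z = σ * symmDiff₂ R z := fun z => by
    rw [hf, ← hh, map_smul, coinStep_pow_symmDiff₂]
    rfl
  refine (coinStep_variance_le hεI l R y).trans ?_
  have hsmul : ∀ (c : ℝ) (F : ℤ → ℝ),
      c * (coinStep ε ^ l) F y = (coinStep ε ^ l) (fun z => c * F z) y := fun c F => by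
    rw [show (fun z => c * F z) = c • F from rfl, map_smul]
    rfl
  rw [hsmul, coinStep_pow_succ]
  refine coinStep_pow_mono hεI l (fun w => ?_) y
  set r : ℝ := √((N : ℝ) + 1) with hr
  have hr0 : 0 < r := Real.sqrt_pos.2 (by positivity)
  have hlr : ((l : ℝ) + 1) ≤ 2 * r := by
    have : ((l : ℝ) + 1) ^ 2 ≤ (2 * r) ^ 2 := by
      rw [mul_pow, Real.sq_sqrt (by positivity)]
      norm_num
      exact_mod_cast hlN
    exact le_of_sq_le_sq this (by positivity)
  have htail := coinStep_symmDiff₂_le hεI N h0 h1 hσ L w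
  rw [coinStep_pow_succ', coinStep_pow_symmDiff₂, ← hR, ← hfR, le_div_iff₀ hr0] at htail
  have hsq : symmDiff₂ R w ^ 2 = f w ^ 2 := by rw [hfR, mul_pow, hσ, one_mul]
  have hfA : f w ≤ 4 * coinStep ε R w := by
    rw [coinStep_apply]
    have a1 := hR0 (w + 1)
    have a2 := hR0 (w - 1)
    have a3 := hfR w
    rw [symmDiff₂] at a3
    rcases mul_self_eq_one_iff.1 (show σ * σ = 1 by rwa [← sq]) with rfl | rfl <;> nlinarith
  have hA0 : 0 ≤ coinStep ε R w := by
    have := coinStep_pow_nonneg hεI 1 hR0 w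
    rwa [pow_one] at this
  have hq : 0 ≤ (1 - ε ^ 2) / 4 := by nlinarith
  have e0 := Real.exp_pos (-L)
  calc ((l : ℝ) + 1) * ((1 - ε ^ 2) / 4) * symmDiff₂ R w ^ 2
      ≤ (2 * r) * ((1 - ε ^ 2) / 4) * f w ^ 2 := by rw [hsq]; gcongr
    _ = 2 * f w * ((1 - ε ^ 2) / 4 * f w * r) := by ring
    _ ≤ 2 * f w * (L * coinStep ε R w + 2 * Real.exp (-L)) :=
        mul_le_mul_of_nonneg_left htail (by linarith [hf0 w])
    _ = 2 * L * f w * coinStep ε R w + 4 * Real.exp (-L) * f w := by ring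
    _ ≤ 2 * L * f w * coinStep ε R w + 4 * Real.exp (-L) * (4 * coinStep ε R w) := by gcongr
    _ = coinStep ε (fun z => R z * (2 * L * f w + 16 * Real.exp (-L))) w := by
        rw [coinStep_apply, coinStep_apply]; ring
    _ ≤ coinStep ε (fun z => R z * localPotential ε L N z) w := by
        rw [coinStep_apply, coinStep_apply]
        have b1 : 2 * L * f w + 16 * Real.exp (-L) ≤ localPotential ε L N (w + 1) := by
          rw [localPotential, ← hf, add_sub_cancel_right]
          have := mul_nonneg (mul_nonneg zero_le_two hL) (hf0 (w + 1 + 1))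
          linarith
        have b2 : 2 * L * f w + 16 * Real.exp (-L) ≤ localPotential ε L N (w - 1) := by
          rw [localPotential, ← hf, sub_add_cancel]
          have := mul_nonneg (mul_nonneg zero_le_two hL) (hf0 (w - 1 - 1))
          linarith
        have c1 := mul_le_mul_of_nonneg_left b1 (hR0 (w + 1))
        have c2 := mul_le_mul_of_nonneg_left b2 (hR0 (w - 1))
        have p1 : 0 ≤ (1 + ε) / 2 := by linarith
        have p2 : 0 ≤ (1 - ε) / 2 := by linarith
        gcongr

/-- For coins that are not too biased, the bias in the simple game is at most the local
potential of the initial state. -/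
lemma gameBias_simple_le_localPotential {m : ℕ} {ε : ℝ} (hε : |ε| ≤ 1 / 2) {L : ℝ} (hL : 0 ≤ L)
    (b : ℕ → ℤ → Bool → Bool) :
    gameBias m ε 0 (simpleHint m ε) b ≤ localPotential ε L (sRound m 1) 0 := by
  obtain ⟨hε1, hε2⟩ := abs_le.1 hε
  have hεI : ε ∈ Set.Icc (-1 : ℝ) 1 := ⟨by linarith, by linarith⟩
  have hmean : ∀ k, k ≤ m → ∀ y, (coinStep ε ^ lRound m k)
      (localPotential ε L (sRound m (k + 1))) y = localPotential ε L (sRound m k) y := by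
    intro k hk y
    rw [coinStep_pow_localPotential, sRound_eq_add hk]
  have hl : ∀ k, k ≤ m → 1 ≤ lRound m k ∧ lRound m k ^ 2 ≤ 4 * (sRound m (k + 1) + 1) := by
    intro k hk
    have h1 := two_mul_sRound (m := m) (k := k + 1) (by omega)
    have h2 : lRound m k = lRound m (k + 1) + 1 := by unfold lRound; omega
    rw [h2]
    refine ⟨by omega, ?_⟩
    nlinarith [sq_nonneg (lRound m (k + 1) : ℤ)]
  have ht : ∀ k, k ≤ m → ∀ y, winVar m ε k y ≤ (coinStep ε ^ lRound m k)
      (fun z => winProb m ε (k + 1) z * localPotential ε L (sRound m (k + 1)) z) y := by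
    intro k hk y
    have := coinStep_variance_le_localPotential hε hL (hl k hk).1 (hl k hk).2 nonnegInd_nonneg
      nonnegInd_le_one (one_pow 2) (one_smul ℝ _) y
    rwa [← winProb, coinStep_pow_winProb hk] at this
  have hf : ∀ k, k ≤ m → ∀ y, winVar m ε k y ≤ (coinStep ε ^ lRound m k)
      (fun z => (1 - winProb m ε (k + 1) z) * localPotential ε L (sRound m (k + 1)) z) y := by
    intro k hk y
    have := coinStep_variance_le_localPotential hε hL (hl k hk).1 (hl k hk).2
      (h := fun z => 1 - nonnegInd z) (fun z => sub_nonneg.2 (nonnegInd_le_one z))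
      (fun z => sub_le_self _ (nonnegInd_nonneg z)) (σ := -1) (by norm_num)
      (by funext z; simp [symmDiff₂]) y
    have e : (coinStep ε ^ sRound m (k + 1)) (fun z => 1 - nonnegInd z) =
        fun z => 1 - winProb m ε (k + 1) z := funext fun z => coinStep_pow_one_sub _ _ _ _
    have e2 : (coinStep ε ^ lRound m k) (fun z => (1 - winProb m ε (k + 1) z) ^ 2) y =
        1 - 2 * winProb m ε k y +
          (coinStep ε ^ lRound m k) (fun z => winProb m ε (k + 1) z ^ 2) y := by
      simp only [sq]
      rw [coinStep_pow_one_sub_mul, coinStep_pow_one_sub]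
      simp only [mul_comm (winProb m ε (k + 1) _) (1 - _)]
      rw [coinStep_pow_one_sub_mul, coinStep_pow_winProb hk]
      ring
    rw [e, coinStep_pow_one_sub, coinStep_pow_winProb hk, e2] at this
    rw [winVar]
    linarith
  have hsplit := fun k y => coinStep_pow_one_sub_mul ε (lRound m k) (winProb m ε (k + 1))
    (localPotential ε L (sRound m (k + 1))) y
  refine gameBias_simple_le hεI b (fun k => localPotential ε L (sRound m k))
    (fun k y => localPotential_nonneg hεI hL _ y) (fun k hk y => (hmean k hk y).le)
    (fun k hk y => ?_) (fun k hk y => ?_)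
  · linarith [hmean k hk y, hf k hk y, hsplit k y]
  · linarith [hmean k hk y, ht k hk y, hsplit k y]

lemma localPotential_le {ε : ℝ} (hε : |ε| ≤ 1 / 2) {L : ℝ} (hL : 0 ≤ L) (n : ℕ) (y : ℤ) :
    localPotential ε L n y ≤ 128 / 3 * L / √((n : ℝ) + 1) + 16 * Real.exp (-L) := by
  obtain ⟨hε1, hε2⟩ := abs_le.1 hε
  have hεI : ε ∈ Set.Icc (-1 : ℝ) 1 := ⟨by linarith, by linarith⟩
  have hb : ∀ z, (coinStep ε ^ n) (symmDiff₂ nonnegInd) z ≤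
      32 / 3 * (1 / √((n : ℝ) + 1)) := by
    intro z
    have h1 := coinStep_symmDiff₂_le hεI n nonnegInd_nonneg nonnegInd_le_one (one_pow 2) 0 z
    rw [neg_zero, Real.exp_zero, zero_mul, one_mul, zero_add, mul_one, div_eq_mul_one_div 2] at h1
    have h2 := coinStep_pow_nonneg hεI n symmDiff₂_nonnegInd_nonneg z
    nlinarith [mul_nonneg h2 (show 0 ≤ 1 / 4 - ε ^ 2 by nlinarith)]
  have h1 := hb (y - 1)
  have h2 := hb (y + 1)
  have h3 := mul_le_mul_of_nonneg_left (add_le_add h1 h2) (mul_nonneg zero_le_two hL)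
  rw [localPotential, mul_div_assoc, div_eq_mul_one_div L]
  linarith

theorem stmt_16 :
    ∃ ξ : ℝ, 0 < ξ ∧ ∀ m : ℕ, 2 ≤ m → ∀ ε : ℝ, ε ∈ Set.Icc (-1 : ℝ) 1 →
      ∀ b : ℕ → ℤ → Bool → Bool,
        gameBias m ε 0 (simpleHint m ε) b ≤ ξ * Real.logb 2 m ^ 3 / m := by
  refine ⟨102, by norm_num, fun m hm ε hε b => ?_⟩
  have hm0 : (0 : ℝ) < m := by exact_mod_cast (by omega : 0 < m)
  have hm2 : (2 : ℝ) ≤ m := by exact_mod_cast hm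
  have hs2 : 2 * sRound m 1 = m * (m + 1) := by
    simpa [lRound] using two_mul_sRound (m := m) (k := 1) (by omega)
  have hlog1 : 1 ≤ Real.logb 2 m := by
    rw [Real.le_logb_iff_rpow_le (by norm_num) hm0, Real.rpow_one]
    exact hm2
  have hlog3 : Real.logb 2 m ≤ Real.logb 2 m ^ 3 := le_self_pow₀ hlog1 (by norm_num)
  by_cases hε' : |ε| ≤ 1 / 2
  · set L := Real.log m with hLdef
    have hL : 0 ≤ L := Real.log_nonneg (by linarith)
    have hLb : L ≤ Real.logb 2 m := by
      rw [Real.logb, le_div_iff₀ (Real.log_pos one_lt_two)]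
      exact mul_le_of_le_one_right hL (by linarith [Real.log_two_lt_d9])
    have hexp : Real.exp (-L) = 1 / m := by
      rw [Real.exp_neg, hLdef, Real.exp_log hm0, one_div]
    have hsqrt : (m : ℝ) / 2 ≤ √((sRound m 1 : ℝ) + 1) := by
      refine Real.le_sqrt_of_sq_le ?_
      have : (2 : ℝ) * sRound m 1 = m * (m + 1) := by exact_mod_cast hs2
      nlinarith
    calc gameBias m ε 0 (simpleHint m ε) b
        ≤ 128 / 3 * L / √((sRound m 1 : ℝ) + 1) + 16 * Real.exp (-L) :=
          (gameBias_simple_le_localPotential hε' hL b).trans (localPotential_le hε' hL _ _)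
      _ ≤ 128 / 3 * L / (m / 2) + 16 * (1 / m) := by rw [hexp]; gcongr
      _ = (256 / 3 * L + 16) / m := by field_simp; ring
      _ ≤ 102 * Real.logb 2 m ^ 3 / m := by gcongr; linarith
  · have hs1 : m ≤ sRound m 1 := by nlinarith
    have hs0 : 0 < sRound m 1 := by omega
    have h16 : (16 : ℝ) / sRound m 1 ≤ 102 * Real.logb 2 m ^ 3 / m := by
      have : (m : ℝ) ≤ sRound m 1 := by exact_mod_cast hs1
      gcongr
      linarith
    have hP0 := winProb_nonneg hε m 1 0
    have hP1 := winProb_le_one hε m 1 0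
    refine (gameBias_simple_le_variance hε b).trans (le_trans ?_ h16)
    rcases lt_abs.1 (not_le.1 hε') with hpos | hneg
    · have h := coinStep_pow_zero_le_of_drift hε hs0 (σ := -1) (h := fun z => 1 - nonnegInd z)
        (by norm_num) (by linarith) (fun z => by
          unfold nonnegInd
          split_ifs with hz
          · rw [sub_self]; exact (Real.exp_pos _).le
          · rw [sub_zero, Real.one_le_exp_iff]
            have : (z : ℝ) ≤ 0 := by exact_mod_cast (not_le.1 hz).le
            linarith)
      rw [coinStep_pow_one_sub, ← winProb] at h
      nlinarith
    · have h := coinStep_pow_zero_le_of_drift hε hs0 (σ := 1) (h := nonnegInd)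
        (by norm_num) (by linarith) (fun z => by
          unfold nonnegInd
          split_ifs with hz
          · rw [Real.one_le_exp_iff]
            have : (0 : ℝ) ≤ z := by exact_mod_cast hz
            linarith
          · exact (Real.exp_pos _).le)
      rw [← winProb] at h
      nlinarith
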